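/- Let X be a regular curve and f : X → X a homeomorphism with no periodic points and with at least two distinct minimal sets. Then the family M_c(f) of minimal sets of f having finitely many connected components is not dense in the space M(f) of all minimal sets of f, where M(f) is endowed with the Hausdorff metric. -/

import Mathlib

open Set Filter Metric Topology

/-- The defining condition of a regular curve: every point has arbitrarily small
open neighborhoods with finite boundary. (Together with the instance assumptions
`Nonempty`, `CompactSpace`, `ConnectedSpace` on a metric space, this says `X` is a
regular curve.) -/
def regularCurveAx (X : Type*) [MetricSpace X] : Prop :=
  ∀ (x : X) (V : Set X), IsOpen V → x ∈ V →
    ∃ U : Set X, IsOpen U ∧ x ∈ U ∧ U ⊆ V ∧ (frontier U).Finite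

/-- The ω-limit set of `x` under `f`: all limits of `f^[n i] x` along a strictly
increasing sequence of integers `n`. -/
def omegaSet {X : Type*} [MetricSpace X] (f : X → X) (x : X) : Set X :=
  {y | ∃ n : ℕ → ℕ, StrictMono n ∧ Tendsto (fun i => f^[n i] x) atTop (𝓝 y)}

/-- `M` is a minimal set of `f`: nonempty, closed, strongly invariant, and without
any proper nonempty closed strongly invariant subset. -/
def IsMinimalSet {X : Type*} [MetricSpace X] (f : X → X) (M : Set X) : Prop :=
  M.Nonempty ∧ IsClosed M ∧ f '' M = M ∧
    ∀ N : Set X, N ⊆ M → N.Nonempty → IsClosed N → f '' N = N → N = M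

/-- `U` is an open set with finite frontier separating `M` from `N`. -/
def IsFiniteCut {X : Type*} [TopologicalSpace X] (M N U : Set X) : Prop :=
  IsOpen U ∧ (frontier U).Finite ∧ M ⊆ U ∧ Disjoint (closure U) N

/-- `U` is a finite cut whose frontier has the least possible number of points. -/
def IsLeastCut {X : Type*} [TopologicalSpace X] (M N U : Set X) : Prop :=
  IsFiniteCut M N U ∧ ∀ V, IsFiniteCut M N V → (frontier U).ncard ≤ (frontier V).ncard

section Cuts

variable {X : Type*} [TopologicalSpace X] {M N U V : Set X}

theorem frontier_union_subset_union (U V : Set X) :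
    frontier (U ∪ V) ⊆ frontier U ∪ frontier V :=
  (frontier_union_subset U V).trans (union_subset_union inter_subset_left inter_subset_right)

theorem frontier_inter_subset_union (U V : Set X) :
    frontier (U ∩ V) ⊆ frontier U ∪ frontier V :=
  (frontier_inter_subset U V).trans (union_subset_union inter_subset_left inter_subset_right)

theorem frontier_inter_inter_frontier_union_subset (hU : IsOpen U) (hV : IsOpen V) :
    frontier (U ∩ V) ∩ frontier (U ∪ V) ⊆ frontier U ∩ frontier V := by
  rintro x ⟨h₁, h₂⟩
  rw [(hU.inter hV).frontier_eq] at h₁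
  rw [(hU.union hV).frontier_eq] at h₂
  rw [hU.frontier_eq, hV.frontier_eq]
  exact ⟨⟨closure_mono inter_subset_left h₁.1, fun h => h₂.2 (Or.inl h)⟩,
    ⟨closure_mono inter_subset_right h₁.1, fun h => h₂.2 (Or.inr h)⟩⟩

/-- The number of frontier points of open sets is submodular. -/
theorem ncard_frontier_inter_add_ncard_frontier_union_le (hU : IsOpen U) (hV : IsOpen V)
    (hfU : (frontier U).Finite) (hfV : (frontier V).Finite) :
    (frontier (U ∩ V)).ncard + (frontier (U ∪ V)).ncard ≤
      (frontier U).ncard + (frontier V).ncard := by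
  have hf := hfU.union hfV
  have h₁ := hf.subset (frontier_inter_subset_union U V)
  have h₂ := hf.subset (frontier_union_subset_union U V)
  rw [← ncard_union_add_ncard_inter _ _ h₁ h₂, ← ncard_union_add_ncard_inter _ _ hfU hfV]
  exact add_le_add
    (ncard_le_ncard (union_subset (frontier_inter_subset_union U V)
      (frontier_union_subset_union U V)) hf)
    (ncard_le_ncard (frontier_inter_inter_frontier_union_subset hU hV)
      (hfU.subset inter_subset_left))

theorem IsFiniteCut.inter (hU : IsFiniteCut M N U) (hV : IsFiniteCut M N V) :
    IsFiniteCut M N (U ∩ V) :=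
  ⟨hU.1.inter hV.1, (hU.2.1.union hV.2.1).subset (frontier_inter_subset_union U V),
    subset_inter hU.2.2.1 hV.2.2.1, hU.2.2.2.mono_left (closure_mono inter_subset_left)⟩

theorem IsFiniteCut.union (hU : IsFiniteCut M N U) (hV : IsFiniteCut M N V) :
    IsFiniteCut M N (U ∪ V) :=
  ⟨hU.1.union hV.1, (hU.2.1.union hV.2.1).subset (frontier_union_subset_union U V),
    hU.2.2.1.trans subset_union_left, by
      rw [closure_union]
      exact hU.2.2.2.union_left hV.2.2.2⟩

theorem IsLeastCut.inter (hU : IsLeastCut M N U) (hV : IsLeastCut M N V) :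
    IsLeastCut M N (U ∩ V) := by
  refine ⟨hU.1.inter hV.1, fun W hW => ?_⟩
  have h₁ := ncard_frontier_inter_add_ncard_frontier_union_le hU.1.1 hV.1.1 hU.1.2.1 hV.1.2.1
  have h₂ := hV.2 _ (hU.1.union hV.1)
  have h₃ := hU.2 _ hW
  omega

theorem IsFiniteCut.exists_isLeastCut (hU : IsFiniteCut M N U) : ∃ V, IsLeastCut M N V := by
  obtain ⟨V, hV, hmin⟩ := exists_minimalFor_of_wellFoundedLT (IsFiniteCut M N)
    (fun V => (frontier V).ncard) ⟨U, hU⟩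
  exact ⟨V, hV, fun W hW => (le_total _ _).elim id fun h => hmin hW h⟩

theorem IsFiniteCut.image (f : X ≃ₜ X) (hM : f '' M = M) (hN : f '' N = N)
    (hU : IsFiniteCut M N U) : IsFiniteCut M N (f '' U) := by
  refine ⟨f.isOpenMap _ hU.1, ?_, ?_, ?_⟩
  · rw [← f.image_frontier]
    exact hU.2.1.image f
  · rw [← hM]
    exact image_mono hU.2.2.1
  · rw [← f.image_closure, ← hN]
    exact (disjoint_image_iff f.injective).2 hU.2.2.2

theorem IsLeastCut.image (f : X ≃ₜ X) (hM : f '' M = M) (hN : f '' N = N)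
    (hU : IsLeastCut M N U) : IsLeastCut M N (f '' U) := by
  refine ⟨hU.1.image f hM hN, fun V hV => ?_⟩
  rw [← f.image_frontier, ncard_image_of_injective _ f.injective]
  exact hU.2 V hV

/-- Finitely many members of a nonempty family of sets that is closed under binary
intersections have a common lower bound in the family. -/
theorem exists_subset_of_forall_inter {α ι : Type*} {p : Set α → Prop} (hne : ∃ U, p U)
    (hinter : ∀ U V, p U → p V → p (U ∩ V)) {t : Set ι} (ht : t.Finite) (g : ι → Set α)
    (hg : ∀ i ∈ t, p (g i)) : ∃ W, p W ∧ ∀ i ∈ t, W ⊆ g i := by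
  induction t, ht using Set.Finite.induction_on with
  | empty => exact hne.imp fun U hU => ⟨hU, by simp⟩
  | @insert a s _ _ ih =>
    obtain ⟨W, hW, hWs⟩ := ih fun i hi => hg i (mem_insert_of_mem _ hi)
    refine ⟨g a ∩ W, hinter _ _ (hg a (mem_insert _ _)) hW, ?_⟩
    rintro i (rfl | hi)
    · exact inter_subset_left
    · exact inter_subset_right.trans (hWs i hi)

end Cuts

section RegularCurve

variable {X : Type*} [MetricSpace X] {M N : Set X}

theorem exists_isFiniteCut [CompactSpace X] (hreg : regularCurveAx X) (hM : IsClosed M)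
    (hN : IsClosed N) (hMN : Disjoint M N) : ∃ U, IsFiniteCut M N U := by
  obtain ⟨V, hV, hMV, hVN⟩ := normal_exists_closure_subset hM hN.isOpen_compl
    (subset_compl_iff_disjoint_right.2 hMN)
  have key : ∃ U : Set X, IsOpen U ∧ (frontier U).Finite ∧ M ⊆ U ∧ U ⊆ V := by
    refine hM.isCompact.induction_on
      (p := fun s => ∃ U : Set X, IsOpen U ∧ (frontier U).Finite ∧ s ⊆ U ∧ U ⊆ V) ?_ ?_ ?_ ?_
    · exact ⟨∅, isOpen_empty, by simp, subset_rfl, empty_subset _⟩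
    · rintro s t hst ⟨U, h₁, h₂, h₃, h₄⟩
      exact ⟨U, h₁, h₂, hst.trans h₃, h₄⟩
    · rintro s t ⟨U, h₁, h₂, h₃, h₄⟩ ⟨U', h₁', h₂', h₃', h₄'⟩
      exact ⟨U ∪ U', h₁.union h₁', (h₂.union h₂').subset (frontier_union_subset_union U U'),
        union_subset_union h₃ h₃', union_subset h₄ h₄'⟩
    · intro x hx
      obtain ⟨U, hU, hxU, hUV, hfU⟩ := hreg x V hV (hMV hx)
      exact ⟨U, mem_nhdsWithin_of_mem_nhds (hU.mem_nhds hxU), U, hU, hfU, subset_rfl, hUV⟩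
  obtain ⟨U, hU, hfU, hMU, hUV⟩ := key
  exact ⟨U, hU, hfU, hMU,
    subset_compl_iff_disjoint_right.1 ((closure_mono hUV).trans hVN)⟩

/-- In a connected regular space, let `Z` be the intersection of the closures of a family of open
sets closed under binary intersections. Then near each frontier point of `Z`, all sufficiently
small members of the family have frontier points. -/
theorem exists_forall_frontier_inter_nonempty [ConnectedSpace X] (hreg : regularCurveAx X)
    {p : Set X → Prop} (hne : ∃ U, p U) (hopen : ∀ U, p U → IsOpen U)
    (hinter : ∀ U V, p U → p V → p (U ∩ V)) {z : X}
    (hz : z ∈ frontier (⋂ U ∈ {U | p U}, closure U)) {O : Set X} (hO : IsOpen O) (hzO : z ∈ O) :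
    ∃ U, p U ∧ ∀ W, p W → W ⊆ U → (frontier W ∩ O).Nonempty := by
  set Z : Set X := ⋂ U ∈ {U | p U}, closure U with hZ
  have hZc : IsClosed Z := isClosed_biInter fun _ _ => isClosed_closure
  have hzZ : ∀ U, p U → z ∈ closure U := fun U hU =>
    mem_iInter₂.1 (hZc.frontier_subset hz) U hU
  have hnotZ : ∀ y, y ∉ Z → ∃ U, p U ∧ y ∉ closure U := by
    intro y hy
    simpa [hZ] using hy
  by_contra! hcon
  have hmiss : ∀ W, frontier W ∩ O = ∅ → IsOpen W → closure W ∩ O ⊆ W := by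
    rintro W hW hWo x ⟨hx, hxO⟩
    by_contra hxW
    have : x ∈ frontier W ∩ O := ⟨by rw [hWo.frontier_eq]; exact ⟨hx, hxW⟩, hxO⟩
    simp [hW] at this
  obtain ⟨O₁, hO₁, hzO₁, hO₁O⟩ : ∃ O₁, IsOpen O₁ ∧ z ∈ O₁ ∧ closure O₁ ⊆ O := by
    obtain ⟨O₁, h₁, h₂, h₃⟩ := normal_exists_closure_subset (isClosed_singleton (x := z)) hO
      (singleton_subset_iff.2 hzO)
    exact ⟨O₁, h₁, singleton_subset_iff.1 h₂, h₃⟩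
  obtain ⟨B, hB, hzB, hBO₁, hfB⟩ := hreg z O₁ hO₁ hzO₁
  have hBO : closure B ⊆ O := (closure_mono hBO₁).trans hO₁O
  choose! g hg hgn using hnotZ
  obtain ⟨U₀, hU₀, hU₀Z⟩ := exists_subset_of_forall_inter hne hinter
    (hfB.subset (sdiff_subset (t := Z))) g fun y hy => hg y hy.2
  obtain ⟨U, hU, hUU₀, hUO⟩ := hcon U₀ hU₀
  have hzU : z ∈ U := hmiss U hUO (hopen U hU) ⟨hzZ U hU, hzO⟩
  obtain ⟨y, ⟨hyB, hyU⟩, hyZ⟩ : ((B ∩ U) ∩ Zᶜ).Nonempty := by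
    rw [frontier_eq_closure_inter_closure] at hz
    exact mem_closure_iff.1 hz.2 _ (hB.inter (hopen U hU)) ⟨hzB, hzU⟩
  obtain ⟨W, hW, hWs, hWO⟩ := hcon (U ∩ g y) (hinter _ _ hU (hg y hyZ))
  have hyW : y ∉ closure W := fun h => hgn y hyZ (closure_mono (hWs.trans inter_subset_right) h)
  have hclosed : IsClosed ((U ∩ B) \ closure W) := by
    refine isClosed_of_closure_subset fun x hx => ?_
    have hxU : x ∈ closure U :=
      closure_mono (sdiff_subset.trans inter_subset_left) hx
    have hxB : x ∈ closure B := closure_mono (sdiff_subset.trans inter_subset_right) hx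
    have hxU' : x ∈ U := hmiss U hUO (hopen U hU) ⟨hxU, hBO hxB⟩
    have hxW : x ∉ closure W := by
      intro h
      obtain ⟨w, hw, hw'⟩ := mem_closure_iff.1 hx W (hopen W hW)
        (hmiss W hWO (hopen W hW) ⟨h, hBO hxB⟩)
      exact hw'.2 (subset_closure hw)
    refine ⟨⟨hxU', ?_⟩, hxW⟩
    by_contra hxB'
    have hxZ : x ∉ Z := fun h => hxW (mem_iInter₂.1 h W hW)
    have hxf : x ∈ frontier B := by
      rw [hB.frontier_eq]
      exact ⟨hxB, hxB'⟩
    exact hgn x hxZ (closure_mono (hUU₀.trans (hU₀Z x ⟨hxf, hxZ⟩)) hxU)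
  have hclopen : IsClopen ((U ∩ B) \ closure W) :=
    ⟨hclosed, ((hopen U hU).inter hB).sdiff isClosed_closure⟩
  rcases isClopen_iff.1 hclopen with h | h
  · exact (h ▸ (⟨⟨hyU, hyB⟩, hyW⟩ : y ∈ (U ∩ B) \ closure W) : y ∈ (∅ : Set X))
  · exact (h ▸ mem_univ z : z ∈ (U ∩ B) \ closure W).2 (hzZ W hW)

/-- The intersection of the closures of all least cuts has a finite frontier. -/
theorem finite_frontier_iInter_isLeastCut [ConnectedSpace X] (hreg : regularCurveAx X)
    (hne : ∃ U, IsLeastCut M N U) :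
    (frontier (⋂ U ∈ {U | IsLeastCut M N U}, closure U)).Finite := by
  obtain ⟨U₀, hU₀⟩ := hne
  by_contra hinf
  obtain ⟨t, hts, htc⟩ := Set.Infinite.exists_subset_card_eq hinf ((frontier U₀).ncard + 1)
  obtain ⟨O, hO, hdis⟩ := t.finite_toSet.t2_separation
  have hex : ∀ z ∈ (t : Set X), ∃ U, IsLeastCut M N U ∧
      ∀ W, IsLeastCut M N W → W ⊆ U → (frontier W ∩ O z).Nonempty := fun z hz =>
    exists_forall_frontier_inter_nonempty hreg ⟨U₀, hU₀⟩ (fun U hU => hU.1.1)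
      (fun U V hU hV => hU.inter hV) (hts hz) (hO z).2 (hO z).1
  choose! g hg hgW using hex
  obtain ⟨W, hW, hWg⟩ := exists_subset_of_forall_inter ⟨U₀, hU₀⟩
    (fun U V (hU : IsLeastCut M N U) (hV : IsLeastCut M N V) => hU.inter hV)
    t.finite_toSet g hg
  choose! q hq using fun z hz => hgW z hz W hW (hWg z hz)
  have hinj : InjOn q (t : Set X) := by
    intro a ha b hb hab
    by_contra hne
    exact disjoint_left.1 (hdis ha hb hne) (hq a ha).2 (hab ▸ (hq b hb).2)
  have h₁ := ncard_le_ncard_of_injOn q (fun z hz => (hq z hz).1) hinj hW.1.2.1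
  have h₂ := hW.2 U₀ hU₀.1
  rw [ncard_coe_finset] at h₁
  omega

theorem exists_iterate_eq_of_mapsTo_finite {α : Type*} {f : α → α} (hf : f.Injective)
    {s : Set α} (hs : s.Finite) (hne : s.Nonempty) (hmaps : MapsTo f s s) :
    ∃ x, ∃ n, 1 ≤ n ∧ f^[n] x = x := by
  obtain ⟨x, hx⟩ := hne
  obtain ⟨i, j, hij, h⟩ := hs.exists_lt_map_eq_of_forall_mem
    (f := fun n : ℕ => f^[n] x) fun n => hmaps.iterate n hx
  refine ⟨x, j - i, by omega, hf.iterate i ?_⟩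
  rw [← Function.iterate_add_apply, Nat.add_sub_cancel' hij.le]
  exact h.symm

/-- Disjoint nonempty closed invariant sets of a homeomorphism of a regular curve force a
periodic point. -/
theorem exists_periodic_of_disjoint_invariant [CompactSpace X] [ConnectedSpace X]
    (hreg : regularCurveAx X) (f : X ≃ₜ X) (hMc : IsClosed M) (hNc : IsClosed N)
    (hMne : M.Nonempty) (hNne : N.Nonempty) (hM : f '' M = M) (hN : f '' N = N)
    (hMN : Disjoint M N) : ∃ x, ∃ n, 1 ≤ n ∧ (⇑f)^[n] x = x := by
  obtain ⟨U₁, hU₁⟩ := exists_isFiniteCut hreg hMc hNc hMN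
  obtain ⟨U₀, hU₀⟩ := hU₁.exists_isLeastCut
  have hfin := finite_frontier_iInter_isLeastCut hreg ⟨U₀, hU₀⟩
  set Z : Set X := ⋂ U ∈ {U | IsLeastCut M N U}, closure U with hZ
  have hsymm : ∀ s : Set X, f '' s = s → f.symm '' s = s := fun s hs => by
    conv_lhs => rw [← hs]
    exact f.toEquiv.symm_image_image s
  have hfZ : f '' Z = Z := by
    refine Subset.antisymm ?_ fun x hx => ⟨f.symm x, ?_, f.apply_symm_apply x⟩
    · rintro _ ⟨x, hx, rfl⟩
      refine mem_iInter₂.2 fun U hU => ?_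
      have h := mem_iInter₂.1 hx _ (hU.image f.symm (hsymm M hM) (hsymm N hN))
      rw [← f.symm.image_closure] at h
      obtain ⟨y, hy, hyx⟩ := h
      rwa [← hyx, f.apply_symm_apply]
    · refine mem_iInter₂.2 fun U hU => ?_
      have h := mem_iInter₂.1 hx _ (hU.image f hM hN)
      rw [← f.image_closure] at h
      obtain ⟨y, hy, hyx⟩ := h
      rwa [← hyx, f.symm_apply_apply]
  refine exists_iterate_eq_of_mapsTo_finite f.injective hfin ?_ ?_
  · rw [nonempty_iff_ne_empty, Ne, ← isClopen_iff_frontier_eq_empty]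
    intro hclopen
    obtain ⟨m, hm⟩ := hMne
    obtain ⟨n, hn⟩ := hNne
    rcases isClopen_iff.1 hclopen with h | h
    · have hmZ : m ∈ Z := mem_iInter₂.2 fun U hU => subset_closure (hU.1.2.2.1 hm)
      rw [h] at hmZ
      exact hmZ
    · have hnZ : n ∈ Z := h ▸ mem_univ n
      exact disjoint_left.1 hU₀.1.2.2.2 (mem_iInter₂.1 hnZ U₀ hU₀) hn
  · intro x hx
    rw [← hfZ, ← f.image_frontier]
    exact mem_image_of_mem f hx

end RegularCurve

theorem IsMinimalSet.eq_or_disjoint {X : Type*} [MetricSpace X] {f : X → X}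
    (hf : f.Injective) {M N : Set X} (hM : IsMinimalSet f M) (hN : IsMinimalSet f N) :
    M = N ∨ Disjoint M N := by
  rw [or_iff_not_imp_right, not_disjoint_iff_nonempty_inter]
  intro hne
  have hc := hM.2.1.inter hN.2.1
  have hinv : f '' (M ∩ N) = M ∩ N := by rw [image_inter hf, hM.2.2.1, hN.2.2.1]
  rw [← hM.2.2.2 _ inter_subset_left hne hc hinv]
  exact hN.2.2.2 _ inter_subset_right hne hc hinv

/-- For a homeomorphism of a regular curve without periodic points having at least
two minimal sets, the family of minimal sets with finitely many connected
components is not dense in the space of all minimal sets (with the Hausdorff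
metric on the hyperspace of nonempty closed subsets). -/
theorem minimalSets_finiteComponents_not_dense {X : Type*} [MetricSpace X] [Nonempty X]
    [CompactSpace X] [ConnectedSpace X] (hreg : regularCurveAx X) (f : X ≃ₜ X)
    (hnoper : ∀ (x : X) (n : ℕ), 1 ≤ n → (⇑f)^[n] x ≠ x)
    (htwo : ∃ M N : Set X, IsMinimalSet (⇑f) M ∧ IsMinimalSet (⇑f) N ∧ M ≠ N) :
    ¬ ({K : TopologicalSpace.NonemptyCompacts X | IsMinimalSet (⇑f) (K : Set X)} ⊆
        closure {K : TopologicalSpace.NonemptyCompacts X |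
          IsMinimalSet (⇑f) (K : Set X) ∧
          {C : Set X | ∃ x ∈ (K : Set X), C = connectedComponentIn (K : Set X) x}.Finite}) := by
  obtain ⟨M, N, hM, hN, hne⟩ := htwo
  obtain ⟨x, n, hn, hx⟩ := exists_periodic_of_disjoint_invariant hreg f hM.2.1 hN.2.1 hM.1 hN.1
    hM.2.2.1 hN.2.2.1 ((hM.eq_or_disjoint f.injective hN).resolve_left hne)
  exact absurd hx (hnoper x n hn)
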